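/- Let A ∈ ℝ^{n×n}, B ∈ ℝ^{n×m}, γ > 0, and suppose every eigenvalue of A (viewed as a complex matrix) has zero real part. If P ∈ ℝ^{n×n} is symmetric positive definite and satisfies the parametric ARE AᵀP + PA − PBBᵀP = −γP, then PBBᵀP ≤ nγP in the Loewner order, i.e. the symmetric matrix nγP − PBBᵀP is positive semidefinite. -/

import Mathlib

open Matrix MeasureTheory Filter Topology

theorem Matrix.trace_eq_zero_of_spectrum_re_eq_zero {n : ℕ} (A : Matrix (Fin n) (Fin n) ℝ)
    (heig : ∀ μ ∈ spectrum ℂ (A.map Complex.ofReal), μ.re = 0) : A.trace = 0 := by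
  have h : ((A.map Complex.ofReal).trace).re = 0 := by
    rw [Matrix.trace_eq_sum_roots_charpoly]
    have hroots : ∀ μ ∈ (A.map Complex.ofReal).charpoly.roots, μ.re = 0 := fun μ hμ =>
      heig μ (Matrix.mem_spectrum_iff_isRoot_charpoly.2 (Polynomial.isRoot_of_mem_roots hμ))
    have hre := map_multiset_sum Complex.reAddGroupHom (A.map Complex.ofReal).charpoly.roots
    refine hre.trans (Multiset.sum_eq_zero fun x hx => ?_)
    obtain ⟨μ, hμ, rfl⟩ := Multiset.mem_map.1 hx
    exact hroots μ hμ
  simpa [Matrix.trace] using h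

theorem Matrix.posSemidef_trace_smul_one_sub_mul_transpose {n m : ℕ}
    (D : Matrix (Fin n) (Fin m) ℝ) :
    ((D * Dᵀ).trace • (1 : Matrix (Fin n) (Fin n) ℝ) - D * Dᵀ).PosSemidef := by
  refine Matrix.PosSemidef.of_dotProduct_mulVec_nonneg ?_ fun x => ?_
  · simp [Matrix.IsHermitian, Matrix.conjTranspose_eq_transpose_of_trivial]
  · have hquad : x ⬝ᵥ ((D * Dᵀ) *ᵥ x) = ∑ j, (∑ i, D i j * x i) ^ 2 := by
      rw [← Matrix.mulVec_mulVec, Matrix.dotProduct_mulVec, ← Matrix.mulVec_transpose]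
      simp [dotProduct, Matrix.mulVec, sq]
    have htrace : (D * Dᵀ).trace = ∑ j, ∑ i, D i j ^ 2 := by
      rw [Finset.sum_comm]
      simp [Matrix.trace, Matrix.mul_apply, sq]
    have hnorm : x ⬝ᵥ x = ∑ i, x i ^ 2 := by simp [dotProduct, sq]
    rw [star_trivial, Matrix.sub_mulVec, dotProduct_sub, Matrix.smul_mulVec, Matrix.one_mulVec,
      dotProduct_smul, hquad, htrace, hnorm, smul_eq_mul, sub_nonneg, Finset.sum_mul]
    exact Finset.sum_le_sum fun j _ => Finset.sum_mul_sq_le_sq_mul_sq _ _ _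

open scoped MatrixOrder in
theorem Matrix.PosSemidef.exists_eq_transpose_mul_self {n : ℕ} {P : Matrix (Fin n) (Fin n) ℝ}
    (hP : P.PosSemidef) : ∃ C : Matrix (Fin n) (Fin n) ℝ, P = Cᵀ * C := by
  obtain ⟨C, hC⟩ := CStarAlgebra.nonneg_iff_eq_star_mul_self.1 hP.nonneg
  exact ⟨C, by rwa [Matrix.star_eq_conjTranspose,
    Matrix.conjTranspose_eq_transpose_of_trivial] at hC⟩

/-- If all eigenvalues of `A` lie on the imaginary axis and `P ≻ 0` solves the parametric ARE
`AᵀP + PA − PBBᵀP = −γP` with `γ > 0`, then `PBBᵀP ≤ nγP` in the Loewner order. -/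
theorem stmt_10 {n m : ℕ}
    (A : Matrix (Fin n) (Fin n) ℝ) (B : Matrix (Fin n) (Fin m) ℝ) (γ : ℝ) (hγ : 0 < γ)
    (heig : ∀ μ ∈ spectrum ℂ (A.map Complex.ofReal), μ.re = 0)
    (P : Matrix (Fin n) (Fin n) ℝ) (hP : P.PosDef)
    (hare : Aᵀ * P + P * A - P * B * Bᵀ * P = -(γ • P)) :
    Matrix.PosSemidef (((n : ℝ) * γ) • P - P * B * Bᵀ * P) := by
  have hA := A.trace_eq_zero_of_spectrum_re_eq_zero heig
  have hdet : IsUnit P.det := (Matrix.isUnit_iff_isUnit_det _).1 hP.isUnit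
  have htr : (P * B * Bᵀ).trace = n * γ := by
    have h := congrArg (fun M => (M * P⁻¹).trace) hare
    simp only [sub_mul, add_mul, neg_mul, smul_mul_assoc,
      Matrix.mul_nonsing_inv_cancel_right _ _ hdet,
      Matrix.mul_nonsing_inv _ hdet, Matrix.trace_sub, Matrix.trace_add, Matrix.trace_neg,
      Matrix.trace_smul, Matrix.trace_one, Matrix.trace_transpose] at h
    rw [Matrix.trace_mul_comm (P * A), Matrix.nonsing_inv_mul_cancel_left _ _ hdet, hA] at h
    simp at h
    linarith
  obtain ⟨C, hC⟩ := hP.posSemidef.exists_eq_transpose_mul_self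
  have hD : (C * B * (C * B)ᵀ).trace = n * γ := by
    rw [← htr, Matrix.transpose_mul, hC, Matrix.trace_mul_comm, Matrix.mul_assoc (Cᵀ * C),
      Matrix.mul_assoc Cᵀ, Matrix.trace_mul_comm Cᵀ, Matrix.trace_mul_comm]
    simp only [Matrix.mul_assoc]
  have h := (C * B).posSemidef_trace_smul_one_sub_mul_transpose.conjTranspose_mul_mul_same C
  rw [hD, Matrix.conjTranspose_eq_transpose_of_trivial] at h
  convert h using 1
  rw [hC]
  simp [Matrix.mul_sub, Matrix.sub_mul, Matrix.mul_assoc]
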